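/- For every 0 < β < 1, every t > 0 and every natural number n, the n-th moment of g_β(·;t) satisfies ∫_0^∞ s^n g_β(s;t) ds = n! · t^{nβ} / Γ(nβ + 1). -/

import Mathlib

open MeasureTheory Real Set Filter

/-- The Wright-type density `g_β(x;t) = t^{-β} ∑_{k} (−x/t^β)^k / (k! Γ(1 − β(k+1)))`. -/
noncomputable def wrightG (β x t : ℝ) : ℝ :=
  t ^ (-β) * ∑' k : ℕ, (-x / t ^ β) ^ k / ((Nat.factorial k : ℝ) * Real.Gamma (1 - β * (k + 1)))

/-- The two-parameter Mittag-Leffler function `E_{β,α}(z) = ∑_k z^k / Γ(βk + α)`. -/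
noncomputable def mittagLeffler (β α z : ℝ) : ℝ :=
  ∑' k : ℕ, z ^ k / Real.Gamma (β * k + α)

/-- The Caputo fractional derivative of order `β ∈ (0,1)`:
`D_c^β h(t) = (1/Γ(1−β)) ∫_0^t (t−τ)^{−β} h′(τ) dτ`. -/
noncomputable def caputo (β : ℝ) (h : ℝ → ℝ) (t : ℝ) : ℝ :=
  (1 / Real.Gamma (1 - β)) * ∫ τ in (0:ℝ)..t, (t - τ) ^ (-β) * deriv h τ

/-- A function is of exponential order on `[0,∞)` if `|h(x)| ≤ C e^{a x}` there. -/
def ExpOrder (h : ℝ → ℝ) : Prop :=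
  ∃ C a : ℝ, 0 < C ∧ 0 < a ∧ ∀ x : ℝ, 0 ≤ x → |h x| ≤ C * Real.exp (a * x)

open scoped Topology

theorem integrableOn_rpow_mul_exp_neg_mul {p c : ℝ} (hp : 0 < p) (hc : 0 < c) :
    IntegrableOn (fun r : ℝ => r ^ (p - 1) * Real.exp (-c * r)) (Ioi 0) := by
  simpa using integrableOn_rpow_mul_exp_neg_mul_rpow (p := 1) (s := p - 1) (by linarith) one_pos hc

/-- Identity theorem on the right half-plane for functions agreeing on the real segment `(0, 1)`. -/
theorem eqOn_re_pos_of_eqOn_Ioo {f g : ℂ → ℂ} (hf : ∀ z : ℂ, 0 < z.re → DifferentiableAt ℂ f z)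
    (hg : ∀ z : ℂ, 0 < z.re → DifferentiableAt ℂ g z)
    (hfg : ∀ x : ℝ, 0 < x → x < 1 → f x = g x) {z : ℂ} (hz : 0 < z.re) : f z = g z := by
  have hopen : IsOpen {z : ℂ | 0 < z.re} := isOpen_lt continuous_const Complex.continuous_re
  have hpre : IsPreconnected {z : ℂ | 0 < z.re} := (convex_halfSpace_re_gt 0).isPreconnected
  have hmem : ((1 / 2 : ℝ) : ℂ) ∈ {z : ℂ | 0 < z.re} :=
    show 0 < ((1 / 2 : ℝ) : ℂ).re by rw [Complex.ofReal_re]; norm_num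
  refine AnalyticOnNhd.eqOn_of_preconnected_of_frequently_eq (z₀ := ((1 / 2 : ℝ) : ℂ))
    (DifferentiableOn.analyticOnNhd (fun z hz => (hf z hz).differentiableWithinAt) hopen)
    (DifferentiableOn.analyticOnNhd (fun z hz => (hg z hz).differentiableWithinAt) hopen)
    hpre hmem ?_ hz
  have htend : Tendsto (fun x : ℝ => (x : ℂ)) (𝓝[≠] (1 / 2 : ℝ)) (𝓝[≠] ((1 / 2 : ℝ) : ℂ)) :=
    Complex.continuous_ofReal.continuousAt.continuousWithinAt.tendsto_nhdsWithin
      fun x hx h => hx (Complex.ofReal_injective h)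
  refine htend.frequently (Eventually.frequently ?_)
  have : Ioo (0 : ℝ) 1 ∈ 𝓝 (1 / 2 : ℝ) := Ioo_mem_nhds (by norm_num) (by norm_num)
  filter_upwards [mem_nhdsWithin_of_mem_nhds this] with x hx using hfg x hx.1 hx.2

/-- Gamma integral with complex rate. -/
theorem integral_rpow_mul_cexp_neg_mul {p : ℝ} (hp : 0 < p) {z : ℂ} (hz : 0 < z.re) :
    ∫ t in Ioi (0 : ℝ), ((t ^ (p - 1) : ℝ) : ℂ) * Complex.exp (-(z * t))
      = z ^ (-p : ℂ) * (Real.Gamma p : ℝ) := by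
  refine eqOn_re_pos_of_eqOn_Ioo
    (f := fun z => ∫ t in Ioi (0 : ℝ), ((t ^ (p - 1) : ℝ) : ℂ) * Complex.exp (-(z * t)))
    (g := fun z => z ^ (-p : ℂ) * (Real.Gamma p : ℝ)) (fun z hz => ?_) (fun z hz => ?_)
    (fun x hx _ => ?_) hz
  · have hs : {w : ℂ | z.re / 2 < w.re} ∈ 𝓝 z :=
      (isOpen_lt continuous_const Complex.continuous_re).mem_nhds (half_lt_self hz)
    refine (hasDerivAt_integral_of_dominated_loc_of_deriv_le
      (F' := fun w (t : ℝ) => ((t ^ (p - 1) : ℝ) : ℂ) * (Complex.exp (-(w * t)) * (-t)))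
      (bound := fun t => t ^ (p + 1 - 1) * Real.exp (-(z.re / 2) * t)) hs
      ?_ ?_ ?_ ?_ ?_ ?_).2.differentiableAt
    · exact Eventually.of_forall fun w => Measurable.aestronglyMeasurable (by fun_prop)
    · refine (integrableOn_rpow_mul_exp_neg_mul hp hz).mono'
        (Measurable.aestronglyMeasurable (by fun_prop))
        ((ae_restrict_mem measurableSet_Ioi).mono fun t ht => ?_)
      have ht : 0 < t := ht
      rw [norm_mul, Complex.norm_real, Real.norm_of_nonneg (by positivity), Complex.norm_exp]
      simp
    · exact Measurable.aestronglyMeasurable (by fun_prop)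
    · refine (ae_restrict_mem measurableSet_Ioi).mono fun t ht w hw => ?_
      have ht : 0 < t := ht
      have hw : z.re / 2 < w.re := hw
      rw [norm_mul, norm_mul, norm_neg, Complex.norm_real, Complex.norm_real,
        Real.norm_of_nonneg (by positivity), Real.norm_of_nonneg ht.le, Complex.norm_exp,
        add_sub_right_comm, Real.rpow_add_one ht.ne', mul_assoc, mul_comm _ t]
      gcongr
      simp only [Complex.neg_re, Complex.re_mul_ofReal]
      nlinarith
    · exact integrableOn_rpow_mul_exp_neg_mul (by linarith) (by linarith)
    · refine Eventually.of_forall fun t w _ => ?_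
      have h : HasDerivAt (fun w : ℂ => -(w * t)) (-(t : ℂ)) w := by
        have h := ((hasDerivAt_id w).mul_const (t : ℂ)).neg
        rw [one_mul] at h
        exact h
      exact h.cexp.const_mul _
  · exact (differentiableAt_id.cpow_const (Or.inl hz)).mul_const _
  · rw [← Complex.ofReal_neg, ← Complex.ofReal_cpow hx.le, ← Complex.ofReal_mul,
      Real.rpow_neg hx.le, ← Real.inv_rpow hx.le, ← one_div,
      ← Real.integral_rpow_mul_exp_neg_mul_Ioi hp hx,
      ← integral_complex_ofReal]
    push_cast
    rfl

/-- Gamma integral along a rotated ray. -/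
theorem integral_rpow_mul_cexp_ray {p ρ φ : ℝ} (hp : 0 < p) (hρ : 0 < ρ) (hφ : |φ| < π / 2) :
    ∫ t in Ioi (0 : ℝ), ((t ^ (p - 1) : ℝ) : ℂ) *
        Complex.exp (-(ρ * Complex.exp (φ * Complex.I) * t))
      = ((ρ ^ (-p) * Real.Gamma p : ℝ) : ℂ) * Complex.exp (-(p * φ : ℝ) * Complex.I) := by
  have hcos : 0 < Real.cos φ := Real.cos_pos_of_mem_Ioo (by rwa [mem_Ioo, ← abs_lt])
  obtain ⟨h1, h2⟩ := abs_lt.1 hφ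
  have hre : 0 < ((ρ : ℂ) * Complex.exp (φ * Complex.I)).re := by
    rw [Complex.re_ofReal_mul, Complex.exp_ofReal_mul_I_re]; positivity
  have hne : (ρ : ℂ) * Complex.exp (φ * Complex.I) ≠ 0 :=
    mul_ne_zero (by simpa using hρ.ne') (Complex.exp_ne_zero _)
  rw [integral_rpow_mul_cexp_neg_mul hp hre, Complex.cpow_def_of_ne_zero hne,
    Complex.log_ofReal_mul hρ (Complex.exp_ne_zero _),
    Complex.log_exp (by simp; linarith [Real.pi_pos]) (by simp; linarith [Real.pi_pos]),
    add_mul, Complex.exp_add, Real.rpow_def_of_pos hρ]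
  push_cast
  ring_nf

theorem integral_rpow_mul_cexp_cexp {p θ : ℝ} (hp : 0 < p) (hθ1 : π / 2 < θ) (hθ2 : θ < π) :
    ∫ r in Ioi (0 : ℝ), ((r ^ (p - 1) : ℝ) : ℂ) * Complex.exp (Complex.exp (θ * Complex.I) * r)
      = ((Real.Gamma p : ℝ) : ℂ) * Complex.exp (-(p * (θ - π) : ℝ) * Complex.I) := by
  have h := integral_rpow_mul_cexp_ray (φ := θ - π) hp one_pos
    (by rw [abs_lt]; constructor <;> linarith)
  have he : ∀ r : ℝ, -(((1 : ℝ) : ℂ) * Complex.exp ((θ - π : ℝ) * Complex.I) * r)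
      = Complex.exp (θ * Complex.I) * r := fun r => by
    rw [Complex.ofReal_sub, sub_mul, Complex.exp_sub, Complex.exp_pi_mul_I]
    push_cast
    ring
  simpa only [he, Real.one_rpow, one_mul] using h

theorem exists_mul_rpow_le_add {β x δ : ℝ} (hβ0 : 0 < β) (hβ1 : β < 1) (hx : 0 ≤ x) (hδ : 0 < δ) :
    ∃ K, ∀ r, 0 < r → x * r ^ β ≤ δ * r + K := by
  obtain ⟨R, hR⟩ : ∃ R : ℝ, ∀ r ≥ R, x ≤ δ * r ^ (1 - β) := by
    have := (tendsto_rpow_atTop (show 0 < 1 - β by linarith)).const_mul_atTop hδ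
    exact eventually_atTop.1 (this.eventually_ge_atTop x)
  refine ⟨x * |R| ^ β, fun r hr => ?_⟩
  rcases le_total R r with h | h
  · have h1 : x * r ^ β ≤ δ * r := by
      calc x * r ^ β ≤ δ * r ^ (1 - β) * r ^ β := by gcongr; exact hR r h
        _ = δ * r := by rw [mul_assoc, ← Real.rpow_add hr]; simp
    have : 0 ≤ x * |R| ^ β := by positivity
    linarith
  · have : x * r ^ β ≤ x * |R| ^ β := by gcongr; exact h.trans (le_abs_self R)
    have : 0 ≤ δ * r := by positivity
    linarith

/-- The integrand of the ray integral representing the Wright density. -/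
noncomputable def wrightRay (β θ x r : ℝ) : ℂ :=
  ((r ^ (β - 1) : ℝ) : ℂ) * (Complex.exp ((β * θ : ℝ) * Complex.I) *
    (Complex.exp (Complex.exp (θ * Complex.I) * r) *
      Complex.exp (-(x * (r ^ β : ℝ) * Complex.exp ((β * θ : ℝ) * Complex.I)))))

theorem norm_exp_exp_mul (θ r : ℝ) :
    ‖Complex.exp (Complex.exp (θ * Complex.I) * r)‖ = Real.exp (Real.cos θ * r) := by
  rw [Complex.norm_exp, Complex.re_mul_ofReal, Complex.exp_ofReal_mul_I_re]

theorem norm_wrightRay (β θ x : ℝ) {r : ℝ} (hr : 0 < r) :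
    ‖wrightRay β θ x r‖ = r ^ (β - 1) *
      (Real.exp (Real.cos θ * r) * Real.exp (-(x * r ^ β * Real.cos (β * θ)))) := by
  rw [wrightRay, norm_mul, norm_mul, norm_mul, norm_exp_exp_mul, Complex.norm_exp_ofReal_mul_I,
    one_mul, Complex.norm_exp, Complex.neg_re, ← Complex.ofReal_mul, Complex.re_ofReal_mul,
    Complex.exp_ofReal_mul_I_re, Complex.norm_real, Real.norm_of_nonneg (by positivity)]

theorem norm_wrightRay_le {β θ x r : ℝ} (hw : 0 < Real.cos (β * θ)) (hx : 0 ≤ x) (hr : 0 < r) :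
    ‖wrightRay β θ x r‖ ≤ r ^ (β - 1) * Real.exp (-(-Real.cos θ) * r) := by
  rw [norm_wrightRay β θ x hr, neg_neg]
  have : Real.exp (-(x * r ^ β * Real.cos (β * θ))) ≤ 1 :=
    Real.exp_le_one_iff.2 (neg_nonpos.2 (by positivity))
  gcongr
  exact mul_le_of_le_one_right (Real.exp_pos _).le this

theorem measurable_wrightRay (β θ : ℝ) : Measurable (Function.uncurry (wrightRay β θ)) := by
  unfold wrightRay Function.uncurry
  fun_prop

theorem im_exp_mul_Gamma {s : ℝ} (hs : 0 < s) :
    (((Real.Gamma s : ℝ) : ℂ) * Complex.exp ((π * s : ℝ) * Complex.I)).im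
      = π * (Real.Gamma (1 - s))⁻¹ := by
  rw [Complex.im_ofReal_mul, Complex.exp_ofReal_mul_I_im]
  have h := Real.Gamma_mul_Gamma_one_sub s
  have hG := (Real.Gamma_pos_of_pos hs).ne'
  have : Real.Gamma (1 - s) = π / (Real.sin (π * s) * Real.Gamma s) := by
    rw [mul_comm (Real.sin _), ← div_div, div_right_comm, ← h]; field_simp
  rw [this, inv_div]
  field_simp

/-- Ray-integral representation of the Wright series. -/
theorem hasSum_wright_series {β θ : ℝ} (hβ0 : 0 < β) (hβ1 : β < 1) (hθ1 : π / 2 < θ) (hθ2 : θ < π)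
    (x : ℝ) :
    HasSum (fun k : ℕ => (-x) ^ k / ((Nat.factorial k : ℝ) * Real.Gamma (1 - β * (k + 1))))
      (π⁻¹ * (∫ r in Ioi (0 : ℝ), wrightRay β θ x r).im) := by
  have hcos : Real.cos θ < 0 := Real.cos_neg_of_pi_div_two_lt_of_lt hθ1 (by linarith)
  set w : ℂ := Complex.exp ((β * θ : ℝ) * Complex.I) with hw
  have hwn : ‖w‖ = 1 := Complex.norm_exp_ofReal_mul_I _
  set F : ℕ → ℝ → ℂ := fun k r => ((r ^ (β * (k + 1) - 1) : ℝ) : ℂ) *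
    Complex.exp (Complex.exp (θ * Complex.I) * r) * (w ^ (k + 1) * ((-x) ^ k / Nat.factorial k : ℝ))
    with hF
  have hFr : ∀ k : ℕ, ∀ r : ℝ, 0 < r → F k r = ((r ^ (β - 1) : ℝ) : ℂ) *
      (w * (Complex.exp (Complex.exp (θ * Complex.I) * r) *
        ((-(x * (r ^ β : ℝ) * w)) ^ k / Nat.factorial k))) := by
    intro k r hr
    have : r ^ (β * (k + 1) - 1) = r ^ (β - 1) * (r ^ β) ^ k := by
      rw [← Real.rpow_mul_natCast hr.le, ← Real.rpow_add hr]; ring_nf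
    simp only [hF, this]
    push_cast
    rw [neg_pow (x : ℂ), neg_pow ((x : ℂ) * _ * w), mul_pow, mul_pow]
    ring
  have hsum : HasSum (fun k => ∫ r in Ioi (0 : ℝ), F k r)
      (∫ r in Ioi (0 : ℝ), wrightRay β θ x r) := by
    have hexp : ∀ y : ℝ, HasSum (fun k : ℕ => y ^ k / Nat.factorial k) (Real.exp y) := fun y => by
      rw [Real.exp_eq_exp_ℝ]; exact NormedSpace.expSeries_div_hasSum_exp y
    have hb : ∀ r : ℝ, HasSum (fun k : ℕ => r ^ (β - 1) * Real.exp (Real.cos θ * r) *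
        ((|x| * r ^ β) ^ k / Nat.factorial k))
        (r ^ (β - 1) * Real.exp (Real.cos θ * r) * Real.exp (|x| * r ^ β)) :=
      fun r => (hexp _).mul_left _
    refine hasSum_integral_of_dominated_convergence
      (fun (k : ℕ) (r : ℝ) => r ^ (β - 1) * Real.exp (Real.cos θ * r) *
        ((|x| * r ^ β) ^ k / Nat.factorial k)) ?_ ?_ ?_ ?_ ?_
    · exact fun k => Measurable.aestronglyMeasurable (by fun_prop)
    · refine fun k => (ae_restrict_mem measurableSet_Ioi).mono fun r hr => ?_
      have hr : 0 < r := hr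
      rw [hFr k r hr]
      simp only [norm_mul, norm_div, norm_pow, norm_neg, hwn, norm_exp_exp_mul, Complex.norm_real,
        Real.norm_eq_abs, abs_of_pos (Real.rpow_pos_of_pos hr _), Complex.norm_natCast]
      apply le_of_eq
      ring
    · exact Eventually.of_forall fun r => (hb r).summable
    · simp_rw [fun r => (hb r).tsum_eq]
      obtain ⟨K, hK⟩ := exists_mul_rpow_le_add hβ0 hβ1 (abs_nonneg x)
        (show 0 < -Real.cos θ / 2 by linarith)
      refine ((integrableOn_rpow_mul_exp_neg_mul hβ0
        (show 0 < -Real.cos θ / 2 by linarith)).mul_const (Real.exp K)).mono'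
        (Measurable.aestronglyMeasurable (by fun_prop))
        ((ae_restrict_mem measurableSet_Ioi).mono fun r hr => ?_)
      have hr : 0 < r := hr
      rw [Real.norm_of_nonneg (by positivity), mul_assoc, mul_assoc, ← Real.exp_add,
        ← Real.exp_add]
      refine mul_le_mul_of_nonneg_left (Real.exp_le_exp.2 ?_) (by positivity)
      linarith [hK r hr]
    · refine (ae_restrict_mem measurableSet_Ioi).mono fun r hr => ?_
      have hr : 0 < r := hr
      have h : HasSum (fun k : ℕ => (-(x * (r ^ β : ℝ) * w)) ^ k / (Nat.factorial k : ℂ))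
          (Complex.exp (-(x * (r ^ β : ℝ) * w))) := by
        rw [Complex.exp_eq_exp_ℂ]; exact NormedSpace.expSeries_div_hasSum_exp _
      simp_rw [fun k => hFr k r hr]
      exact ((h.mul_left _).mul_left w).mul_left _
  have hterm : ∀ k : ℕ, ∫ r in Ioi (0 : ℝ), F k r
      = (((-x) ^ k / Nat.factorial k : ℝ) : ℂ) * (((Real.Gamma (β * (k + 1)) : ℝ) : ℂ) *
        Complex.exp ((π * (β * (k + 1)) : ℝ) * Complex.I)) := by
    intro k
    simp only [hF]
    rw [integral_mul_const, integral_rpow_mul_cexp_cexp (by positivity) hθ1 hθ2, hw,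
      ← Complex.exp_nat_mul]
    have : Complex.exp ((π * (β * (k + 1)) : ℝ) * Complex.I)
        = Complex.exp (-(β * (k + 1) * (θ - π) : ℝ) * Complex.I) *
          Complex.exp (((k + 1 : ℕ) : ℂ) * ((β * θ : ℝ) * Complex.I)) := by
      rw [← Complex.exp_add]; push_cast; ring_nf
    rw [this]
    ring
  have him := (Complex.hasSum_im hsum).mul_left π⁻¹
  refine (congrArg (HasSum · _) (funext fun k => ?_)).mpr him
  rw [hterm, Complex.im_ofReal_mul, im_exp_mul_Gamma (by positivity)]
  field_simp

theorem integrableOn_wrightRay {β θ x : ℝ} (hβ0 : 0 < β) (hθ : Real.cos θ < 0)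
    (hw : 0 < Real.cos (β * θ)) (hx : 0 ≤ x) : IntegrableOn (wrightRay β θ x) (Ioi 0) := by
  refine (integrableOn_rpow_mul_exp_neg_mul hβ0 (neg_pos.2 hθ)).mono'
    ((measurable_wrightRay β θ).of_uncurry_left.aestronglyMeasurable)
    ((ae_restrict_mem measurableSet_Ioi).mono fun r hr => ?_)
  exact norm_wrightRay_le hw hx hr

/-- Uniform Taylor remainder bound for `exp` along a ray in the left half-plane. -/
theorem exists_norm_exp_sub_sum_le {θ : ℝ} (hθ : Real.cos θ ≤ 0) (J : ℕ) :
    ∃ C : ℝ, ∀ r : ℝ, 0 < r → ‖Complex.exp (Complex.exp (θ * Complex.I) * r) -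
      ∑ j ∈ Finset.range J, (Complex.exp (θ * Complex.I) * r) ^ j / Nat.factorial j‖ ≤ C * r ^ J := by
  refine ⟨Real.exp 1 + (1 + J), fun r hr => ?_⟩
  have hn : ‖Complex.exp (θ * Complex.I) * r‖ = r := by
    rw [norm_mul, Complex.norm_exp_ofReal_mul_I, one_mul, Complex.norm_real,
      Real.norm_of_nonneg hr.le]
  have hrJ : 0 ≤ r ^ J := by positivity
  rcases le_total r 1 with h | h
  · refine (Complex.norm_exp_sub_sum_le_norm_mul_exp _ J).trans ?_
    rw [hn]
    nlinarith [Real.exp_le_exp.2 h, mul_nonneg hrJ (show (0 : ℝ) ≤ 1 + J by positivity),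
      mul_le_mul_of_nonneg_left (Real.exp_le_exp.2 h) hrJ]
  · have h1 : ‖Complex.exp (Complex.exp (θ * Complex.I) * r)‖ ≤ r ^ J := by
      rw [norm_exp_exp_mul]
      exact (Real.exp_le_one_iff.2 (by nlinarith)).trans (one_le_pow₀ h)
    have h2 : ‖∑ j ∈ Finset.range J, (Complex.exp (θ * Complex.I) * r) ^ j / Nat.factorial j‖
        ≤ J * r ^ J := by
      refine (norm_sum_le_of_le
        (f := fun j => (Complex.exp (θ * Complex.I) * r) ^ j / Nat.factorial j)
        (n := fun _ => r ^ J) _ fun j hj => ?_).trans (by simp)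
      rw [norm_div, norm_pow, hn, Complex.norm_natCast]
      exact (div_le_self (by positivity) (Nat.one_le_cast.2 (Nat.factorial_pos j))) |>.trans
        (pow_le_pow_right₀ h (Finset.mem_range.1 hj).le)
    have := Real.exp_pos 1
    nlinarith [norm_sub_le (Complex.exp (Complex.exp (θ * Complex.I) * r))
      (∑ j ∈ Finset.range J, (Complex.exp (θ * Complex.I) * r) ^ j / Nat.factorial j),
      mul_nonneg this.le hrJ]

/-- The integrand obtained from `wrightRay` by keeping one Taylor term of the outer exponential. -/
noncomputable def wrightRayTerm (β θ x : ℝ) (j : ℕ) (r : ℝ) : ℂ :=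
  ((r ^ (β - 1) : ℝ) : ℂ) * (Complex.exp ((β * θ : ℝ) * Complex.I) *
    ((Complex.exp (θ * Complex.I) * r) ^ j / Nat.factorial j *
      Complex.exp (-(x * (r ^ β : ℝ) * Complex.exp ((β * θ : ℝ) * Complex.I)))))

theorem norm_cexp_neg_mul_cexp (x y φ : ℝ) :
    ‖Complex.exp (-(x * (y : ℝ) * Complex.exp (φ * Complex.I)))‖
      = Real.exp (-(x * Real.cos φ) * y) := by
  rw [Complex.norm_exp, Complex.neg_re, ← Complex.ofReal_mul, Complex.re_ofReal_mul,
    Complex.exp_ofReal_mul_I_re]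
  ring_nf

theorem integrableOn_wrightRayTerm {β θ x : ℝ} (hβ0 : 0 < β)
    (hw : 0 < Real.cos (β * θ)) (hx : 0 < x) (j : ℕ) :
    IntegrableOn (wrightRayTerm β θ x j) (Ioi 0) := by
  refine (integrableOn_rpow_mul_exp_neg_mul_rpow (s := β - 1 + j) (by
    have : (0 : ℝ) ≤ j := by positivity
    linarith) hβ0 (mul_pos hx hw)).mono'
    (Measurable.aestronglyMeasurable (by unfold wrightRayTerm; fun_prop))
    ((ae_restrict_mem measurableSet_Ioi).mono fun r hr => ?_)
  have hr : 0 < r := hr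
  rw [wrightRayTerm, norm_mul, norm_mul, norm_mul, norm_cexp_neg_mul_cexp, norm_div, norm_pow,
    norm_mul, Complex.norm_exp_ofReal_mul_I, Complex.norm_exp_ofReal_mul_I, Complex.norm_real,
    Complex.norm_real, Real.norm_of_nonneg hr.le, Real.norm_of_nonneg (by positivity), one_mul,
    one_mul, Complex.norm_natCast, Real.rpow_add hr, Real.rpow_natCast, mul_assoc]
  gcongr
  exact div_le_self (by positivity) (Nat.one_le_cast.2 (Nat.factorial_pos j))

theorem im_integral_wrightRayTerm {β θ x : ℝ} (hβ0 : 0 < β) (hβθ : |β * θ| < π / 2) (hx : 0 < x)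
    (j : ℕ) : (∫ r in Ioi (0 : ℝ), wrightRayTerm β θ x j r).im = 0 := by
  have h1 := integral_rpow_mul_cexp_ray (p := 1 + j / β) (ρ := x) (φ := β * θ) (by positivity) hx hβθ
  rw [← integral_comp_rpow_Ioi _ hβ0.ne'] at h1
  have h2 : ∫ r in Ioi (0 : ℝ), wrightRayTerm β θ x j r
      = ∫ r in Ioi (0 : ℝ), (Complex.exp ((β * θ : ℝ) * Complex.I) *
          Complex.exp (θ * Complex.I) ^ j * ((β⁻¹ / Nat.factorial j : ℝ) : ℂ)) *
        ((|β| * r ^ (β - 1)) • ((((r ^ β) ^ (1 + j / β - 1) : ℝ) : ℂ) *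
          Complex.exp (-(x * Complex.exp ((β * θ : ℝ) * Complex.I) * (r ^ β : ℝ))))) := by
    refine setIntegral_congr_fun measurableSet_Ioi fun r hr => ?_
    have hr : 0 < r := hr
    have e1 : (r ^ β) ^ (1 + j / β - 1) = r ^ j := by
      rw [← Real.rpow_mul hr.le, ← Real.rpow_natCast]
      congr 1
      field_simp
      ring
    rw [e1, wrightRayTerm, abs_of_pos hβ0, Complex.real_smul]
    push_cast
    rw [mul_pow, mul_right_comm (x : ℂ)]
    have : (β : ℂ) ≠ 0 := by exact_mod_cast hβ0.ne'
    field_simp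
  have h3 : Complex.exp ((β * θ : ℝ) * Complex.I) * Complex.exp (θ * Complex.I) ^ j *
      Complex.exp (-((1 + j / β) * (β * θ) : ℝ) * Complex.I) = 1 := by
    rw [← Complex.exp_nat_mul, ← Complex.exp_add, ← Complex.exp_add, Complex.exp_eq_one_iff]
    refine ⟨0, ?_⟩
    have : (β : ℂ) ≠ 0 := by exact_mod_cast hβ0.ne'
    push_cast
    field_simp
    ring
  rw [h2, integral_const_mul, h1]
  have h4 : ∀ (a b e : ℂ) (c d : ℝ), a * b * e = 1 → (a * b * c * (d * e)).im = 0 := by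
    intro a b e c d h
    rw [show a * b * c * (d * e) = a * b * e * ((c * d : ℝ) : ℂ) by push_cast; ring, h, one_mul,
      Complex.ofReal_im]
  exact h4 _ _ _ _ _ h3

/-- The ray integral has imaginary part decaying faster than any power. -/
theorem exists_abs_im_integral_wrightRay_le {β θ : ℝ} (hβ0 : 0 < β) (hθ : Real.cos θ < 0)
    (hβθ : |β * θ| < π / 2) (J : ℕ) : ∃ C : ℝ, ∀ x : ℝ, 0 < x →
      |(∫ r in Ioi (0 : ℝ), wrightRay β θ x r).im| ≤ C * x ^ (-(1 + J / β)) := by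
  have hw : 0 < Real.cos (β * θ) := Real.cos_pos_of_mem_Ioo (by rwa [mem_Ioo, ← abs_lt])
  obtain ⟨C, hC⟩ := exists_norm_exp_sub_sum_le hθ.le J
  refine ⟨C * (Real.cos (β * θ) ^ (-(1 + J / β)) * (1 / β) * Real.Gamma (1 + J / β)), fun x hx => ?_⟩
  have hJ : -1 < β - 1 + J := by
    have : (0 : ℝ) ≤ J := by positivity
    linarith
  have hint := integrableOn_wrightRay hβ0 hθ hw hx.le
  have hintT := fun j (_ : j ∈ Finset.range J) => integrableOn_wrightRayTerm hβ0 hw hx j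
  have him : (∫ r in Ioi (0 : ℝ), wrightRay β θ x r).im
      = (∫ r in Ioi (0 : ℝ), (wrightRay β θ x r -
          ∑ j ∈ Finset.range J, wrightRayTerm β θ x j r)).im := by
    rw [integral_sub hint (integrable_finsetSum _ hintT), integral_finsetSum _ hintT,
      Complex.sub_im, Complex.im_sum]
    simp [im_integral_wrightRayTerm hβ0 hβθ hx]
  rw [him]
  refine (Complex.abs_im_le_norm _).trans ((norm_integral_le_of_norm_le
    ((integrableOn_rpow_mul_exp_neg_mul_rpow hJ hβ0 (mul_pos hx hw)).const_mul C)
    ((ae_restrict_mem measurableSet_Ioi).mono fun r hr => ?_)).trans (le_of_eq ?_))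
  · have hr : 0 < r := hr
    have : wrightRay β θ x r - ∑ j ∈ Finset.range J, wrightRayTerm β θ x j r
        = ((r ^ (β - 1) : ℝ) : ℂ) * (Complex.exp ((β * θ : ℝ) * Complex.I) *
          ((Complex.exp (Complex.exp (θ * Complex.I) * r) - ∑ j ∈ Finset.range J,
            (Complex.exp (θ * Complex.I) * r) ^ j / Nat.factorial j) *
          Complex.exp (-(x * (r ^ β : ℝ) * Complex.exp ((β * θ : ℝ) * Complex.I))))) := by
      simp only [wrightRay, wrightRayTerm]
      rw [← Finset.mul_sum, ← Finset.mul_sum, ← Finset.sum_mul]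
      ring
    rw [this, norm_mul, norm_mul, norm_mul, norm_cexp_neg_mul_cexp,
      Complex.norm_exp_ofReal_mul_I, Complex.norm_real, Real.norm_of_nonneg (by positivity),
      one_mul, Real.rpow_add hr, Real.rpow_natCast]
    calc _ ≤ r ^ (β - 1) * ((C * r ^ J) * Real.exp (-(x * Real.cos (β * θ)) * r ^ β)) := by
          gcongr; exact hC r hr
      _ = _ := by ring
  · rw [integral_const_mul, integral_rpow_mul_exp_neg_mul_rpow hβ0 hJ (mul_pos hx hw)]
    have e : (β - 1 + J + 1) / β = 1 + J / β := by field_simp; ring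
    rw [neg_div, e, Real.mul_rpow hx.le hw.le]
    ring

theorem mellin_im_integral_wrightRay {β θ s : ℝ} (hβ0 : 0 < β) (hθ1 : π / 2 < θ) (hθ2 : θ < π)
    (hβθ : |β * θ| < π / 2) (hs0 : 0 < s) (hs1 : s < 1) :
    ∫ x in Ioi (0 : ℝ), x ^ (s - 1) * (∫ r in Ioi (0 : ℝ), wrightRay β θ x r).im
      = π * (Real.Gamma s * (Real.Gamma (1 - β * (1 - s)))⁻¹) := by
  have hθ : Real.cos θ < 0 := Real.cos_neg_of_pi_div_two_lt_of_lt hθ1 (by linarith)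
  have hw : 0 < Real.cos (β * θ) := Real.cos_pos_of_mem_Ioo (by rwa [mem_Ioo, ← abs_lt])
  have hs : 0 < β * (1 - s) := mul_pos hβ0 (by linarith)
  set f : ℝ → ℝ → ℂ := fun x r => ((x ^ (s - 1) : ℝ) : ℂ) * wrightRay β θ x r with hf
  have hmeas : Measurable (Function.uncurry f) := by
    simp only [hf, Function.uncurry_def]
    exact (by fun_prop : Measurable fun p : ℝ × ℝ => ((p.1 ^ (s - 1) : ℝ) : ℂ)).mul
      (measurable_wrightRay β θ)
  have hnorm : ∀ r, 0 < r → ∀ x, 0 < x → ‖f x r‖ = r ^ (β - 1) * Real.exp (Real.cos θ * r) *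
      (x ^ (s - 1) * Real.exp (-(r ^ β * Real.cos (β * θ) * x))) := fun r hr x hx => by
    rw [hf]
    simp only
    rw [norm_mul, norm_wrightRay β θ x hr, Complex.norm_real, Real.norm_of_nonneg (by positivity),
      mul_comm x, mul_right_comm _ x]
    ring
  have hint : Integrable (Function.uncurry f)
      ((volume.restrict (Ioi (0 : ℝ))).prod (volume.restrict (Ioi (0 : ℝ)))) := by
    refine (integrable_prod_iff' hmeas.aestronglyMeasurable).2 ⟨?_, ?_⟩
    · refine (ae_restrict_mem measurableSet_Ioi).mono fun r hr => ?_
      have hr : 0 < r := hr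
      refine ((integrableOn_rpow_mul_exp_neg_mul hs0
        (show 0 < r ^ β * Real.cos (β * θ) by positivity)).const_mul
        (r ^ (β - 1) * Real.exp (Real.cos θ * r))).mono'
        (hmeas.of_uncurry_right.aestronglyMeasurable)
        ((ae_restrict_mem measurableSet_Ioi).mono fun x hx => ?_)
      rw [Function.uncurry_apply_pair, hnorm r hr x hx, neg_mul]
    · refine ((integrableOn_rpow_mul_exp_neg_mul hs (neg_pos.2 hθ)).const_mul
        (Real.cos (β * θ) ^ (-s) * Real.Gamma s)).congr
        ((ae_restrict_mem measurableSet_Ioi).mono fun r hr => ?_)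
      have hr : 0 < r := hr
      simp only [Function.uncurry_apply_pair]
      rw [setIntegral_congr_fun measurableSet_Ioi fun x hx => hnorm r hr x hx, integral_const_mul,
        Real.integral_rpow_mul_exp_neg_mul_Ioi hs0 (by positivity), one_div,
        Real.inv_rpow (by positivity), ← Real.rpow_neg (by positivity),
        Real.mul_rpow (by positivity) hw.le, ← Real.rpow_mul hr.le, neg_neg,
        show β * (1 - s) - 1 = (β - 1) + β * (-s) by ring, Real.rpow_add hr]
      ring
  have hswap := integral_integral_swap hint
  have hinner : ∀ r ∈ Ioi (0 : ℝ), ∫ x in Ioi (0 : ℝ), f x r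
      = (((r ^ (β * (1 - s) - 1) : ℝ) : ℂ) * Complex.exp (Complex.exp (θ * Complex.I) * r)) *
        (((Real.Gamma s : ℝ) : ℂ) * Complex.exp ((β * (1 - s) * θ : ℝ) * Complex.I)) := by
    intro r hr
    have hr : 0 < r := hr
    have h := integral_rpow_mul_cexp_ray hs0 (Real.rpow_pos_of_pos hr β) hβθ
    calc ∫ x in Ioi (0 : ℝ), f x r
        = ∫ x in Ioi (0 : ℝ), (((r ^ (β - 1) : ℝ) : ℂ) * (Complex.exp ((β * θ : ℝ) * Complex.I) *
            Complex.exp (Complex.exp (θ * Complex.I) * r))) * (((x ^ (s - 1) : ℝ) : ℂ) *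
            Complex.exp (-(((r ^ β : ℝ) : ℂ) * Complex.exp ((β * θ : ℝ) * Complex.I) * x))) := by
          refine integral_congr_ae (Eventually.of_forall fun x => ?_)
          simp only [hf, wrightRay]
          rw [mul_comm (x : ℂ), mul_right_comm _ (x : ℂ)]
          ring
      _ = _ := by
        rw [integral_const_mul, h, ← Real.rpow_mul hr.le,
          show β * (1 - s) - 1 = (β - 1) + β * (-s) by ring, Real.rpow_add hr,
          show ((β * (1 - s) * θ : ℝ) : ℂ) * Complex.I
            = (β * θ : ℝ) * Complex.I + -(s * (β * θ) : ℝ) * Complex.I by push_cast; ring,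
          Complex.exp_add]
        push_cast
        ring
  have hval : ∫ x in Ioi (0 : ℝ), ((x ^ (s - 1) : ℝ) : ℂ) * ∫ r in Ioi (0 : ℝ), wrightRay β θ x r
      = ((Real.Gamma s : ℝ) : ℂ) * (((Real.Gamma (β * (1 - s)) : ℝ) : ℂ) *
        Complex.exp ((π * (β * (1 - s)) : ℝ) * Complex.I)) := by
    simp_rw [← integral_const_mul]
    rw [show (∫ x in Ioi (0 : ℝ), ∫ r in Ioi (0 : ℝ), ((x ^ (s - 1) : ℝ) : ℂ) * wrightRay β θ x r)
      = _ from hswap, setIntegral_congr_fun measurableSet_Ioi hinner, integral_mul_const,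
      integral_rpow_mul_cexp_cexp hs hθ1 hθ2,
      show ((π * (β * (1 - s)) : ℝ) : ℂ) * Complex.I = -(β * (1 - s) * (θ - π) : ℝ) * Complex.I
        + (β * (1 - s) * θ : ℝ) * Complex.I by push_cast; ring, Complex.exp_add]
    ring
  have hint1 : Integrable (fun x : ℝ => ((x ^ (s - 1) : ℝ) : ℂ) *
      ∫ r in Ioi (0 : ℝ), wrightRay β θ x r) (volume.restrict (Ioi 0)) := by
    simp_rw [← integral_const_mul]
    exact hint.integral_prod_left
  have h4 := integral_im hint1
  simp only [RCLike.im_to_complex, Complex.im_ofReal_mul] at h4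
  rw [h4, hval, Complex.im_ofReal_mul, im_exp_mul_Gamma hs]
  ring

theorem exists_ray_angle {β : ℝ} (hβ0 : 0 < β) (hβ1 : β < 1) :
    ∃ θ : ℝ, π / 2 < θ ∧ θ < π ∧ |β * θ| < π / 2 := by
  have hpi := Real.pi_pos
  obtain ⟨θ, h1, h2⟩ := exists_between (show π / 2 < min π (π / 2 / β) from
    lt_min (by linarith) ((lt_div_iff₀ hβ0).2 (by nlinarith)))
  refine ⟨θ, h1, h2.trans_le (min_le_left _ _), ?_⟩
  have := (lt_div_iff₀ hβ0).1 (h2.trans_le (min_le_right _ _))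
  rw [abs_of_pos (mul_pos hβ0 (by linarith))]
  linarith

/-- Mellin transform of the ray integral, by analytic continuation from `(0, 1)`. -/
theorem mellin_wright {β θ : ℝ} (hβ0 : 0 < β) (hθ1 : π / 2 < θ) (hθ2 : θ < π)
    (hβθ : |β * θ| < π / 2) {s : ℂ} (hs : 0 < s.re) :
    mellin (fun x => (((∫ r in Ioi (0 : ℝ), wrightRay β θ x r).im : ℝ) : ℂ)) s
      = π * (Complex.Gamma s * (Complex.Gamma (1 - β * (1 - s)))⁻¹) := by
  have hθ : Real.cos θ < 0 := Real.cos_neg_of_pi_div_two_lt_of_lt hθ1 (by linarith)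
  have hw : 0 < Real.cos (β * θ) := Real.cos_pos_of_mem_Ioo (by rwa [mem_Ioo, ← abs_lt])
  refine eqOn_re_pos_of_eqOn_Ioo (g := fun s : ℂ =>
    π * (Complex.Gamma s * (Complex.Gamma (1 - β * (1 - s)))⁻¹))
    (fun z hz => ?_) (fun z hz => ?_) (fun s hs0 hs1 => ?_) hs
  · obtain ⟨J, hJ⟩ := exists_nat_gt (z.re * β)
    obtain ⟨C, hC⟩ := exists_abs_im_integral_wrightRay_le hβ0 hθ hβθ J
    refine mellin_differentiableAt_of_isBigO_rpow (a := 1 + J / β) (b := 0) ?_ ?_ ?_ ?_ hz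
    · refine ContinuousOn.locallyIntegrableOn ?_ measurableSet_Ioi
      refine Complex.continuous_ofReal.comp_continuousOn (Complex.continuous_im.comp_continuousOn ?_)
      refine continuousOn_of_dominated
        (bound := fun r => r ^ (β - 1) * Real.exp (-(-Real.cos θ) * r)) ?_ ?_ ?_ ?_
      · exact fun x _ => (measurable_wrightRay β θ).of_uncurry_left.aestronglyMeasurable
      · exact fun x hx => (ae_restrict_mem measurableSet_Ioi).mono fun r hr =>
          norm_wrightRay_le hw (le_of_lt hx) hr
      · exact integrableOn_rpow_mul_exp_neg_mul hβ0 (neg_pos.2 hθ)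
      · refine Eventually.of_forall fun r => Continuous.continuousOn ?_
        unfold wrightRay
        fun_prop
    · refine Asymptotics.IsBigO.of_bound C ((eventually_gt_atTop 0).mono fun x hx => ?_)
      rw [Complex.norm_real, Real.norm_eq_abs, Real.norm_of_nonneg (by positivity)]
      exact hC x hx
    · have := (lt_div_iff₀ hβ0).2 hJ
      linarith
    · refine Asymptotics.IsBigO.of_bound
        (∫ r in Ioi (0 : ℝ), r ^ (β - 1) * Real.exp (-(-Real.cos θ) * r))
        (eventually_mem_nhdsWithin.mono fun x hx => ?_)
      rw [Complex.norm_real, Real.norm_eq_abs, neg_zero, Real.rpow_zero, norm_one, mul_one]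
      exact (Complex.abs_im_le_norm _).trans (norm_integral_le_of_norm_le
        (integrableOn_rpow_mul_exp_neg_mul hβ0 (neg_pos.2 hθ))
        ((ae_restrict_mem measurableSet_Ioi).mono fun r hr => norm_wrightRay_le hw (le_of_lt hx) hr))
  · refine ((Complex.differentiableAt_Gamma z fun m h => ?_).mul ?_).const_mul _
    · rw [h] at hz
      simp at hz
      linarith [(Nat.cast_nonneg m : (0 : ℝ) ≤ m)]
    · exact Complex.differentiable_one_div_Gamma.differentiableAt.comp z (by fun_prop)
  · have h := congrArg (fun y : ℝ => (y : ℂ))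
      (mellin_im_integral_wrightRay hβ0 hθ1 hθ2 hβθ hs0 hs1)
    rw [← integral_complex_ofReal] at h
    rw [mellin]
    refine (setIntegral_congr_fun measurableSet_Ioi fun x hx => ?_).trans (h.trans ?_)
    · simp only [smul_eq_mul]
      rw [Complex.ofReal_mul, Complex.ofReal_cpow (le_of_lt hx)]
      push_cast
      rfl
    · push_cast
      simp only [← Complex.Gamma_ofReal]
      push_cast
      rfl

/-- Moments of `g_β(·;t)`:
`∫_0^∞ s^n g_β(s;t) ds = n! · t^{nβ} / Γ(nβ + 1)`. -/
theorem wrightG_moments (β t : ℝ) (hβ0 : 0 < β) (hβ1 : β < 1) (ht : 0 < t) (n : ℕ) :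
    ∫ s in Set.Ioi (0:ℝ), s ^ n * wrightG β s t
      = (Nat.factorial n : ℝ) * t ^ ((n : ℝ) * β) / Real.Gamma ((n : ℝ) * β + 1) := by
  obtain ⟨θ, hθ1, hθ2, hβθ⟩ := exists_ray_angle hβ0 hβ1
  have htβ : 0 < t ^ β := Real.rpow_pos_of_pos ht β
  set M : ℝ → ℝ := fun x => (∫ r in Ioi (0 : ℝ), wrightRay β θ x r).im with hM
  have hmom : ∫ x in Ioi (0 : ℝ), x ^ n * M x
      = π * (Nat.factorial n * (Real.Gamma (n * β + 1))⁻¹) := by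
    have h := mellin_wright hβ0 hθ1 hθ2 hβθ (s := n + 1) (by simp; positivity)
    apply Complex.ofReal_injective
    rw [← integral_complex_ofReal]
    rw [mellin, Complex.Gamma_nat_eq_factorial] at h
    simp only [add_sub_cancel_right, Complex.cpow_natCast, smul_eq_mul] at h
    push_cast
    rw [h, ← Complex.Gamma_ofReal]
    push_cast
    ring_nf
  have hG : ∀ s, s ^ n * wrightG β s t
      = (t ^ (-β) * π⁻¹ * (t ^ β) ^ n) * (((t ^ β)⁻¹ * s) ^ n * M ((t ^ β)⁻¹ * s)) := by
    intro s
    rw [wrightG, neg_div, (hasSum_wright_series hβ0 hβ1 hθ1 hθ2 (s / t ^ β)).tsum_eq, mul_pow,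
      inv_pow, inv_mul_eq_div]
    simp only [hM]
    field_simp
  simp_rw [hG]
  rw [integral_const_mul, integral_comp_mul_left_Ioi (fun x => x ^ n * M x) 0 (inv_pos.2 htβ),
    mul_zero, hmom, inv_inv, smul_eq_mul, mul_comm (n : ℝ) β, Real.rpow_mul ht.le,
    Real.rpow_natCast, Real.rpow_neg ht.le]
  field_simp
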